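/- Let R and B be two disjoint finite sets of points in the plane such that |R| = k|B| for an integer k ≥ 1, B is nonempty, and R ∪ B is in general position. Then there exists a plane bichromatic tree on R ∪ B whose maximum vertex degree is at most k + 2. -/

import Mathlib

open scoped Classical

noncomputable section

/-- The plane. -/
abbrev Pt : Type := ℝ × ℝ

/-- A set of points is in general position if no three of its points are collinear. -/
def GenPos (P : Set Pt) : Prop :=
  ∀ p ∈ P, ∀ q ∈ P, ∀ r ∈ P, p ≠ q → p ≠ r → q ≠ r →
    ¬ Collinear ℝ ({p, q, r} : Set Pt)

/-- Degree of a vertex in a simple graph. -/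
def deg {V : Type*} (G : SimpleGraph V) (v : V) : ℕ := (G.neighborSet v).ncard

/-- `G` is a plane bichromatic spanning tree on `R ∪ B`: a spanning tree of the
geometric complete bipartite graph `K(R,B)` (every edge joins a point of `R` and a
point of `B`), drawn with straight-line segments, no two of which cross (any point
lying on two distinct closed edges is a common endpoint of both). -/
def PlaneBichromTree (R B : Finset Pt) (G : SimpleGraph {x : Pt // x ∈ R ∪ B}) : Prop :=
  G.IsTree ∧
  (∀ u v : {x : Pt // x ∈ R ∪ B}, G.Adj u v →
      ((u.1 ∈ R ∧ v.1 ∈ B) ∨ (u.1 ∈ B ∧ v.1 ∈ R))) ∧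
  (∀ u v x y : {x : Pt // x ∈ R ∪ B}, G.Adj u v → G.Adj x y →
      s(u, v) ≠ s(x, y) →
      ∀ p : Pt, p ∈ segment ℝ u.1 v.1 → p ∈ segment ℝ x.1 y.1 →
        (p = u.1 ∨ p = v.1) ∧ (p = x.1 ∨ p = y.1))

/-- Orientation determinant. -/
def dt (p x y : Pt) : ℝ := (x.1 - p.1) * (y.2 - p.2) - (x.2 - p.2) * (y.1 - p.1)

/-- Linear functional based at `w`. -/
def lf (a b : ℝ) (w x : Pt) : ℝ := a * (x.1 - w.1) + b * (x.2 - w.2)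

/-- `w` is a strictly extreme point of `T`. -/
def Extr (T : Finset Pt) (w : Pt) : Prop := ∃ a b : ℝ, ∀ x ∈ T, x ≠ w → 0 < lf a b w x

/-- Plane bichromatic tree supported on `S`. -/
structure Tr (R : Finset Pt) (S : Finset Pt) (G : SimpleGraph Pt) : Prop where
  supp : ∀ u v, G.Adj u v → u ∈ S
  conn : ∀ u ∈ S, ∀ v ∈ S, G.Reachable u v
  fin : G.edgeSet.Finite
  cnt : G.edgeSet.ncard + 1 ≤ S.card
  bic : ∀ u v, G.Adj u v → (u ∈ R ↔ v ∉ R)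
  pln : ∀ u v x y, G.Adj u v → G.Adj x y → s(u, v) ≠ s(x, y) →
      ∀ p : Pt, p ∈ segment ℝ u v → p ∈ segment ℝ x y →
        (p = u ∨ p = v) ∧ (p = x ∨ p = y)

theorem lf_seg {a b : ℝ} {w u v z : Pt} (h : z ∈ segment ℝ u v) :
    ∃ s t : ℝ, 0 ≤ s ∧ 0 ≤ t ∧ s + t = 1 ∧ s • u + t • v = z ∧
      lf a b w z = s * lf a b w u + t * lf a b w v := by
  obtain ⟨s, t, hs, ht, hst, rfl⟩ := h
  refine ⟨s, t, hs, ht, hst, rfl, ?_⟩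
  have : s = 1 - t := by linarith
  subst this
  simp [lf]
  ring

theorem cross_aux {S1 S2 : Finset Pt} {a b : ℝ} {w : Pt} {P : Set Pt} (hP : GenPos P)
    (h1P : ∀ x ∈ S1, x ∈ P) (hw : w ∈ S1)
    (h1 : ∀ x ∈ S1, lf a b w x ≤ 0) (h2 : ∀ x ∈ S2, x ≠ w → 0 < lf a b w x)
    {u v x y z : Pt} (hu : u ∈ S1) (hv : v ∈ S1) (huv : u ≠ v) (hx : x ∈ S2) (hy : y ∈ S2)
    (hxy : x ≠ y)
    (hz1 : z ∈ segment ℝ u v) (hz2 : z ∈ segment ℝ x y) :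
    (z = u ∨ z = v) ∧ (z = x ∨ z = y) := by
  have hww : lf a b w w = 0 := by simp [lf]
  have h2' : ∀ x ∈ S2, 0 ≤ lf a b w x := by
    intro x hx
    by_cases h : x = w
    · rw [h, hww]
    · exact (h2 x hx h).le
  obtain ⟨s, t, hs, ht, hst, hz, hl⟩ := lf_seg (a := a) (b := b) (w := w) hz1
  obtain ⟨s', t', hs', ht', hst', hz', hl'⟩ := lf_seg (a := a) (b := b) (w := w) hz2
  have e1 := mul_nonneg hs (neg_nonneg.2 (h1 u hu))
  have e2 := mul_nonneg ht (neg_nonneg.2 (h1 v hv))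
  have e3 := mul_nonneg hs' (h2' x hx)
  have e4 := mul_nonneg ht' (h2' y hy)
  have e5 : s' * lf a b w x = 0 := by linarith
  have e6 : t' * lf a b w y = 0 := by linarith
  have key : z = w ∧ (z = x ∨ z = y) := by
    rcases mul_eq_zero.1 e5 with h | h
    · have : t' = 1 := by linarith
      subst h this
      have hzy : z = y := by rw [← hz']; simp
      have : y = w := by
        by_contra hne
        have := h2 y hy hne
        linarith
      exact ⟨hzy.trans this, Or.inr hzy⟩
    · have hxw : x = w := by
        by_contra hne
        have := h2 x hx hne
        linarith
      have hyw : y ≠ w := fun h => hxy (hxw.trans h.symm)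
      have := h2 y hy hyw
      rcases mul_eq_zero.1 e6 with h' | h'
      · have : s' = 1 := by linarith
        subst h' this
        have hzy : z = x := by rw [← hz']; simp
        exact ⟨hzy.trans hxw, Or.inl hzy⟩
      · linarith
  refine ⟨?_, key.2⟩
  by_contra hne
  push Not at hne
  have hzw := key.1
  subst hzw
  refine hP u (h1P u hu) z (h1P z hw) v (h1P v hv) hne.1.symm huv hne.2 ?_
  exact (mem_segment_iff_wbtw.1 hz1).collinear

theorem deg_eq_zero {R S : Finset Pt} {G : SimpleGraph Pt} (h : Tr R S G) {v : Pt} (hv : v ∉ S) :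
    deg G v = 0 := by
  have : G.neighborSet v = ∅ := by
    ext x
    simp only [SimpleGraph.mem_neighborSet, Set.mem_empty_iff_false, iff_false]
    exact fun hx => hv (h.supp _ _ hx)
  simp [deg, this]

theorem deg_sup_le (G1 G2 : SimpleGraph Pt) (v : Pt) :
    deg (G1 ⊔ G2) v ≤ deg G1 v + deg G2 v := by
  have : (G1 ⊔ G2).neighborSet v = G1.neighborSet v ∪ G2.neighborSet v := by
    ext x; simp
  unfold deg
  rw [this]
  exact Set.ncard_union_le _ _

theorem glue {R S1 S2 : Finset Pt} {a b : ℝ} {w : Pt} {P : Set Pt} (hP : GenPos P)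
    (h1P : ∀ x ∈ S1, x ∈ P) (hw1 : w ∈ S1) (hw2 : w ∈ S2)
    (h1 : ∀ x ∈ S1, lf a b w x ≤ 0) (h2 : ∀ x ∈ S2, x ≠ w → 0 < lf a b w x)
    {G1 G2 : SimpleGraph Pt} (t1 : Tr R S1 G1) (t2 : Tr R S2 G2) :
    Tr R (S1 ∪ S2) (G1 ⊔ G2) ∧
      (∀ d, (∀ v, deg G1 v ≤ d) → (∀ v, deg G2 v ≤ d) → ∀ v, v ≠ w → deg (G1 ⊔ G2) v ≤ d) := by
  have hint : S1 ∩ S2 = {w} := by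
    ext x
    simp only [Finset.mem_inter, Finset.mem_singleton]
    constructor
    · rintro ⟨a1, a2⟩
      by_contra hne
      have := h1 x a1
      have := h2 x a2 hne
      linarith
    · rintro rfl
      exact ⟨hw1, hw2⟩
  refine ⟨⟨?_, ?_, ?_, ?_, ?_, ?_⟩, ?_⟩
  · intro u v h
    rw [SimpleGraph.sup_adj] at h
    rw [Finset.mem_union]
    exact h.imp (t1.supp _ _) (t2.supp _ _)
  · have hall : ∀ u ∈ S1 ∪ S2, (G1 ⊔ G2).Reachable u w := by
      intro u hu
      rcases Finset.mem_union.1 hu with hu | hu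
      · exact (t1.conn u hu w hw1).mono le_sup_left
      · exact (t2.conn u hu w hw2).mono le_sup_right
    intro u hu v hv
    exact (hall u hu).trans (hall v hv).symm
  · rw [SimpleGraph.edgeSet_sup]
    exact t1.fin.union t2.fin
  · rw [SimpleGraph.edgeSet_sup]
    have := Set.ncard_union_le G1.edgeSet G2.edgeSet
    have c := Finset.card_union_add_card_inter S1 S2
    rw [hint, Finset.card_singleton] at c
    have := t1.cnt
    have := t2.cnt
    omega
  · intro u v h
    rw [SimpleGraph.sup_adj] at h
    rcases h with h | h
    · exact t1.bic _ _ h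
    · exact t2.bic _ _ h
  · intro u v x y huv hxy hne p hp hp'
    rw [SimpleGraph.sup_adj] at huv hxy
    rcases huv with huv | huv <;> rcases hxy with hxy | hxy
    · exact t1.pln _ _ _ _ huv hxy hne p hp hp'
    · exact cross_aux hP h1P hw1 h1 h2 (t1.supp _ _ huv) (t1.supp _ _ huv.symm) huv.ne
        (t2.supp _ _ hxy) (t2.supp _ _ hxy.symm) hxy.ne hp hp'
    · exact (cross_aux hP h1P hw1 h1 h2 (t1.supp _ _ hxy) (t1.supp _ _ hxy.symm) hxy.ne
        (t2.supp _ _ huv) (t2.supp _ _ huv.symm) huv.ne hp' hp).symm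
    · exact t2.pln _ _ _ _ huv hxy hne p hp hp'
  · intro d d1 d2 v hv
    have hs := deg_sup_le G1 G2 v
    have a1 := d1 v
    have a2 := d2 v
    by_cases m1 : v ∈ S1
    · have m2 : v ∉ S2 := by
        intro m2
        have : v ∈ S1 ∩ S2 := Finset.mem_inter.2 ⟨m1, m2⟩
        rw [hint] at this
        exact hv (Finset.mem_singleton.1 this)
      have := deg_eq_zero t2 m2
      omega
    · have := deg_eq_zero t1 m1
      omega

theorem tr_single (R : Finset Pt) (p : Pt) : Tr R {p} ⊥ := by
  refine ⟨?_, ?_, ?_, ?_, ?_, ?_⟩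
  · intro u v h; simp at h
  · intro u hu v hv
    rw [Finset.mem_singleton] at hu hv
    rw [hu, hv]
  · simp
  · simp
  · intro u v h; simp at h
  · intro u v x y h; simp at h

theorem deg_bot (v : Pt) : deg (⊥ : SimpleGraph Pt) v = 0 := by
  simp [deg]

theorem edge_edges (p q : Pt) (h : p ≠ q) : (SimpleGraph.edge p q).edgeSet = {s(p, q)} := by
  ext e
  induction e with
  | _ x y =>
    simp only [SimpleGraph.mem_edgeSet, SimpleGraph.edge_adj, Set.mem_singleton_iff, Sym2.eq_iff]
    constructor
    · tauto
    · rintro (⟨rfl, rfl⟩ | ⟨rfl, rfl⟩) <;> simp [h, h.symm]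

theorem tr_edge (R : Finset Pt) (p q : Pt) (h : p ≠ q) (hc : p ∈ R ↔ q ∉ R) :
    Tr R {p, q} (SimpleGraph.edge p q) := by
  refine ⟨?_, ?_, ?_, ?_, ?_, ?_⟩
  · intro u v h
    rw [SimpleGraph.edge_adj] at h
    simp; tauto
  · have : (SimpleGraph.edge p q).Reachable p q :=
      SimpleGraph.Adj.reachable (by simp [SimpleGraph.edge_adj, h])
    intro u hu v hv
    simp only [Finset.mem_insert, Finset.mem_singleton] at hu hv
    rcases hu with rfl | rfl <;> rcases hv with rfl | rfl
    · rfl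
    · exact this
    · exact this.symm
    · rfl
  · rw [edge_edges p q h]; simp
  · rw [edge_edges p q h]; simp [Finset.card_pair h]
  · intro u v h
    rw [SimpleGraph.edge_adj] at h
    rcases h with ⟨⟨rfl, rfl⟩ | ⟨rfl, rfl⟩, _⟩ <;> tauto
  · intro u v x y h1 h2 hne
    rw [← SimpleGraph.mem_edgeSet, edge_edges p q h] at h1 h2
    exact absurd (h1.trans h2.symm) hne

theorem deg_edge (p q v : Pt) : deg (SimpleGraph.edge p q) v ≤ 1 := by
  have hs : ((SimpleGraph.edge p q).neighborSet v).Subsingleton := by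
    intro x hx y hy
    simp only [SimpleGraph.mem_neighborSet, SimpleGraph.edge_adj] at hx hy
    grind
  unfold deg
  rcases hs.eq_empty_or_singleton with h | ⟨x, h⟩ <;> simp [h]

theorem dt_pos_of_key {S : Finset Pt} {p : Pt} {P : Set Pt} (hP : GenPos P)
    (hS : ∀ x ∈ S, x ∈ P) (hp : p ∈ S) {a b : ℝ} (he : ∀ x ∈ S, x ≠ p → 0 < lf a b p x)
    {x y : Pt} (hx : x ∈ S) (hy : y ∈ S) (hxp : x ≠ p) (hyp : y ≠ p) (hxy : x ≠ y)
    (hk : lf (-b) a p x / lf a b p x ≤ lf (-b) a p y / lf a b p y) : 0 < dt p x y := by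
  have fx := he x hx hxp
  have fy := he y hy hyp
  rw [div_le_div_iff₀ fx fy] at hk
  have hid : lf (-b) a p y * lf a b p x - lf (-b) a p x * lf a b p y
      = (a ^ 2 + b ^ 2) * dt p x y := by
    simp only [lf, dt]; ring
  have hab : 0 < a ^ 2 + b ^ 2 := by
    by_contra hn
    have h1 : a = 0 := by nlinarith [sq_nonneg a, sq_nonneg b]
    have h2 : b = 0 := by nlinarith [sq_nonneg a, sq_nonneg b]
    simp [lf, h1, h2] at fx
  have hge : 0 ≤ dt p x y := by
    by_contra hn
    push Not at hn
    have := mul_neg_of_pos_of_neg hab hn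
    linarith
  refine lt_of_le_of_ne hge ?_
  intro h0
  refine hP p (hS p hp) x (hS x hx) y (hS y hy) hxp.symm hyp.symm hxy ?_
  rw [collinear_iff_of_mem (p₀ := p) (by simp)]
  refine ⟨x - p, ?_⟩
  intro z hz
  simp only [Set.mem_insert_iff, Set.mem_singleton_iff] at hz
  rcases hz with rfl | rfl | rfl
  · exact ⟨0, by simp⟩
  · exact ⟨1, by simp⟩
  · refine ⟨lf a b p z / lf a b p x, ?_⟩
    have hne := fx.ne'
    simp only [dt] at h0
    ext
    · simp only [vadd_eq_add, Prod.fst_add, Prod.smul_fst, Prod.fst_sub, smul_eq_mul]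
      have : lf a b p z * (x.1 - p.1) = lf a b p x * (z.1 - p.1) := by
        simp only [lf]; linear_combination (-b) * h0
      rw [div_mul_eq_mul_div, this]
      field_simp
      ring
    · simp only [vadd_eq_add, Prod.snd_add, Prod.smul_snd, Prod.snd_sub, smul_eq_mul]
      have : lf a b p z * (x.2 - p.2) = lf a b p x * (z.2 - p.2) := by
        simp only [lf]; linear_combination a * h0
      rw [div_mul_eq_mul_div, this]
      field_simp
      ring

theorem exists_sorted {S : Finset Pt} {p : Pt} {P : Set Pt} (hP : GenPos P)
    (hS : ∀ x ∈ S, x ∈ P) (hp : p ∈ S) (he : Extr S p) :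
    ∃ l : List Pt, l.Nodup ∧ l.toFinset = S.erase p ∧ l.Pairwise (fun x y => 0 < dt p x y) := by
  obtain ⟨a, b, he⟩ := he
  let r : Pt → Pt → Prop := fun x y =>
    lf (-b) a p x / lf a b p x ≤ lf (-b) a p y / lf a b p y
  have : Std.Total r := ⟨fun x y => le_total _ _⟩
  have : IsTrans Pt r := ⟨fun x y z h1 h2 => le_trans h1 h2⟩
  have hperm := List.perm_insertionSort r (S.erase p).toList
  have hnd : (List.insertionSort r (S.erase p).toList).Nodup :=
    hperm.nodup_iff.2 (Finset.nodup_toList _)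
  refine ⟨List.insertionSort r (S.erase p).toList, hnd, ?_, ?_⟩
  · rw [List.toFinset_eq_of_perm _ _ hperm, Finset.toList_toFinset]
  · have h1 := List.pairwise_insertionSort r (S.erase p).toList
    refine (h1.and hnd).imp_of_mem ?_
    intro x y hx hy hxy
    have mx := Finset.mem_erase.1 (Finset.mem_toList.1 (hperm.mem_iff.1 hx))
    have my := Finset.mem_erase.1 (Finset.mem_toList.1 (hperm.mem_iff.1 hy))
    exact dt_pos_of_key hP hS hp he mx.2 my.2 mx.1 my.1 hxy.2 hxy.1

/-- Discrete intermediate value principle along a list. -/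
theorem ivt (wt : Pt → ℤ) (Q : ℤ → Prop) : ∀ (l : List Pt) (acc : ℤ), Q acc →
    ¬ Q (acc + (l.map wt).sum) →
    ∃ l1 q l2, l = l1 ++ q :: l2 ∧ Q (acc + (l1.map wt).sum) ∧
      ¬ Q (acc + (l1.map wt).sum + wt q) := by
  intro l
  induction l with
  | nil => intro acc h1 h2; simp at h2; exact absurd h1 h2
  | cons x l ih =>
    intro acc h1 h2
    by_cases hx : Q (acc + wt x)
    · obtain ⟨l1, q, l2, e, a1, a2⟩ := ih (acc + wt x) hx (by simpa [add_assoc] using h2)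
      refine ⟨x :: l1, q, l2, by simp [e], ?_, ?_⟩
      · simpa [add_assoc] using a1
      · simpa [add_assoc] using a2
    · exact ⟨[], x, l, rfl, by simpa using h1, by simpa using hx⟩

/-- Existence of a tree with root degree bounded by `d`. -/
def Good (k : ℕ) (R S : Finset Pt) (p : Pt) (d : ℕ) : Prop :=
  ∃ G, Tr R S G ∧ (∀ v, deg G v ≤ k + 2) ∧ deg G p ≤ d

theorem dt_lf_p (p q x : Pt) : lf (-(q.2 - p.2)) (q.1 - p.1) p x = dt p q x := by
  simp only [lf, dt]; ring

theorem dt_lf_q (p q x : Pt) : lf (-(q.2 - p.2)) (q.1 - p.1) q x = dt p q x := by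
  simp only [lf, dt]; ring

theorem neg_lf (a b : ℝ) (p x : Pt) : lf (-a) (-b) p x = - lf a b p x := by
  simp only [lf]; ring

theorem dt_swap (p x y : Pt) : dt p x y = - dt p y x := by
  simp only [dt]; ring

theorem dt_self (p x : Pt) : dt p x x = 0 := by
  simp only [dt]; ring

theorem dt_base (p x : Pt) : dt p x p = 0 := by
  simp only [dt]; ring

theorem splitP {k : ℕ} {R S : Finset Pt} {p q : Pt} {P : Set Pt} (hP : GenPos P)
    (hS : ∀ x ∈ S, x ∈ P) (hp : p ∈ S) {l1 l2 : List Pt}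
    (hl : (l1 ++ q :: l2).toFinset = S.erase p)
    (hpw : (l1 ++ q :: l2).Pairwise (fun x y => 0 < dt p x y)) {d1 d2 d : ℕ}
    (g1 : Good k R (insert p (l1 ++ [q]).toFinset) p d1)
    (g2 : Good k R (insert p l2.toFinset) p d2) (hd : d1 + d2 ≤ d) (hd' : d ≤ k + 2) :
    Good k R S p d := by
  obtain ⟨G1, t1, a1, b1⟩ := g1
  obtain ⟨G2, t2, a2, b2⟩ := g2
  have hSu : S = insert p (l1 ++ [q]).toFinset ∪ insert p l2.toFinset := by
    rw [← Finset.insert_erase hp, ← hl]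
    ext x; simp
  rw [List.pairwise_append, List.pairwise_cons] at hpw
  obtain ⟨-, ⟨hq2, -⟩, h12⟩ := hpw
  obtain ⟨t, ht⟩ := glue (a := -(q.2 - p.2)) (b := q.1 - p.1) (w := p) hP
    (fun x hx => hS x (by rw [hSu]; exact Finset.mem_union_left _ hx))
    (Finset.mem_insert_self _ _) (Finset.mem_insert_self _ _)
    (by
      intro x hx
      rw [dt_lf_p]
      simp only [Finset.mem_insert, List.mem_toFinset, List.mem_append, List.mem_singleton] at hx
      rcases hx with rfl | hx | rfl
      · rw [dt_base]
      · have := h12 x hx q (by simp)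
        rw [dt_swap]; linarith
      · rw [dt_self])
    (by
      intro x hx hxp
      rw [dt_lf_p]
      simp only [Finset.mem_insert, List.mem_toFinset] at hx
      rcases hx with rfl | hx
      · exact absurd rfl hxp
      · exact hq2 x hx) t1 t2
  have hpd : deg (G1 ⊔ G2) p ≤ d := by
    have := deg_sup_le G1 G2 p
    omega
  refine ⟨G1 ⊔ G2, ?_, ?_, hpd⟩
  · rw [hSu]; exact t
  · intro v
    by_cases hv : v = p
    · rw [hv]; omega
    · exact ht _ a1 a2 v hv

theorem splitQ {k : ℕ} {R S : Finset Pt} {p q : Pt} {P : Set Pt} (hP : GenPos P)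
    (hS : ∀ x ∈ S, x ∈ P) (hp : p ∈ S) {l1 l2 : List Pt}
    (hl : (l1 ++ q :: l2).toFinset = S.erase p)
    (hpw : (l1 ++ q :: l2).Pairwise (fun x y => 0 < dt p x y)) {d1 d2 : ℕ}
    (hc : p ∈ R ↔ q ∉ R)
    (g1 : Good k R (insert q l1.toFinset) q d1)
    (g2 : Good k R (insert q l2.toFinset) q d2) (hd : d1 + d2 + 1 ≤ k + 2) :
    Good k R S p 1 := by
  obtain ⟨G1, t1, a1, b1⟩ := g1
  obtain ⟨G2, t2, a2, b2⟩ := g2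
  have hSu : S = ({p, q} ∪ insert q l1.toFinset) ∪ insert q l2.toFinset := by
    rw [← Finset.insert_erase hp, ← hl]
    ext x; simp
  have hnp : ∀ x ∈ l1 ++ q :: l2, x ≠ p := by
    intro x hx
    rw [← List.mem_toFinset, hl] at hx
    exact (Finset.mem_erase.1 hx).1
  have hqp : q ≠ p := hnp q (by simp)
  rw [List.pairwise_append, List.pairwise_cons] at hpw
  obtain ⟨-, ⟨hq2, -⟩, h12⟩ := hpw
  have hneg : ∀ x ∈ l1, dt p q x < 0 := by
    intro x hx
    have := h12 x hx q (by simp)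
    rw [dt_swap]; linarith
  have te := tr_edge R p q hqp.symm hc
  obtain ⟨t, ht⟩ := glue (a := -(-(q.2 - p.2))) (b := -(q.1 - p.1)) (w := q) hP
    (fun x hx => hS x (by
      rw [hSu]; exact Finset.mem_union_left _ (Finset.mem_union_left _ hx)))
    (by simp) (Finset.mem_insert_self _ _)
    (by
      intro x hx
      rw [neg_lf, dt_lf_q]
      simp only [Finset.mem_insert, Finset.mem_singleton] at hx
      rcases hx with rfl | rfl
      · rw [dt_base]; simp
      · rw [dt_self]; simp)
    (by
      intro x hx hxp
      rw [neg_lf, dt_lf_q]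
      simp only [Finset.mem_insert, List.mem_toFinset] at hx
      rcases hx with rfl | hx
      · exact absurd rfl hxp
      · have := hneg x hx
        linarith) te t1
  obtain ⟨t', ht'⟩ := glue (a := -(q.2 - p.2)) (b := q.1 - p.1) (w := q) hP
    (fun x hx => hS x (by
      rw [hSu]; exact Finset.mem_union_left _ hx))
    (by simp) (Finset.mem_insert_self _ _)
    (by
      intro x hx
      rw [dt_lf_q]
      simp only [Finset.mem_union, Finset.mem_insert, Finset.mem_singleton,
        List.mem_toFinset] at hx
      rcases hx with (rfl | rfl) | rfl | hx
      · rw [dt_base]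
      · rw [dt_self]
      · rw [dt_self]
      · exact (hneg x hx).le)
    (by
      intro x hx hxp
      rw [dt_lf_q]
      simp only [Finset.mem_insert, List.mem_toFinset] at hx
      rcases hx with rfl | hx
      · exact absurd rfl hxp
      · exact hq2 x hx) t t2
  have e1 := deg_edge p q
  have s1 := deg_sup_le (SimpleGraph.edge p q) G1
  have s2 := deg_sup_le (SimpleGraph.edge p q ⊔ G1) G2
  have hall : ∀ v, deg (SimpleGraph.edge p q ⊔ G1) v ≤ k + 2 := by
    intro v
    by_cases hv : v = q
    · rw [hv]
      have := e1 q
      have := s1 q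
      omega
    · exact ht _ (fun v => (e1 v).trans (by omega)) a1 v hv
  refine ⟨SimpleGraph.edge p q ⊔ G1 ⊔ G2, ?_, ?_, ?_⟩
  · rw [hSu]; exact t'
  · intro v
    by_cases hv : v = q
    · rw [hv]
      have := e1 q
      have := s1 q
      have := s2 q
      omega
    · exact ht' _ hall a2 v hv
  · have z1 := deg_eq_zero t1 (v := p) (by
      simp only [Finset.mem_insert, List.mem_toFinset, not_or]
      exact ⟨hqp.symm, fun h => hnp p (by simp [h]) rfl⟩)
    have z2 := deg_eq_zero t2 (v := p) (by
      simp only [Finset.mem_insert, List.mem_toFinset, not_or]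
      exact ⟨hqp.symm, fun h => hnp p (by simp [h]) rfl⟩)
    have := e1 p
    have := s1 p
    have := s2 p
    omega

/-- Weight of a point. -/
def wt (k : ℕ) (R : Finset Pt) (x : Pt) : ℤ := if x ∈ R then 1 else -(k : ℤ)

/-- Root degree bound. -/
def bd (k : ℕ) (R : Finset Pt) (q : Pt) (W : ℤ) : ℕ :=
  if q ∈ R then max 1 (1 - W).toNat else max 1 (W + k).toNat

theorem main_tree {k : ℕ} (hk : 1 ≤ k) {R : Finset Pt} {P : Set Pt} (hP : GenPos P) :
    ∀ (n : ℕ) (S : Finset Pt), S.card = n → (∀ x ∈ S, x ∈ P) → ∀ p ∈ S, Extr S p →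
      -(k : ℤ) ≤ ∑ x ∈ S, wt k R x → ∑ x ∈ S, wt k R x ≤ 1 →
      Good k R S p (bd k R p (∑ x ∈ S, wt k R x)) := by
  intro n
  induction n using Nat.strong_induction_on with
  | _ n ih =>
  intro S hn hS p hp he hlo hhi
  obtain ⟨l, hnd, hl, hpw⟩ := exists_sorted hP hS hp he
  have hW : ∑ x ∈ S, wt k R x = wt k R p + (l.map (wt k R)).sum := by
    rw [← Finset.add_sum_erase S _ hp, ← hl, List.sum_toFinset _ hnd]
  rw [hW] at hlo hhi ⊢
  have hcard : l.length + 1 = n := by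
    rw [← List.toFinset_card_of_nodup hnd, hl, Finset.card_erase_add_one hp, hn]
  have hmemS : ∀ x ∈ l, x ∈ S ∧ x ≠ p := by
    intro x hx
    rw [← List.mem_toFinset, hl] at hx
    exact ⟨(Finset.mem_erase.1 hx).2, (Finset.mem_erase.1 hx).1⟩
  -- recursion on a rooted piece
  have rec' : ∀ (m : List Pt) (q : Pt), m.Nodup → q ∉ m → (∀ x ∈ m, x ∈ S) → q ∈ S →
      m.length + 1 < n → Extr (insert q m.toFinset) q →
      -(k : ℤ) ≤ wt k R q + (m.map (wt k R)).sum → wt k R q + (m.map (wt k R)).sum ≤ 1 →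
      Good k R (insert q m.toFinset) q (bd k R q (wt k R q + (m.map (wt k R)).sum)) := by
    intro m q hm hq hmS hqS hlen hex h1 h2
    have hq' : q ∉ m.toFinset := by simpa using hq
    have hw : ∑ x ∈ insert q m.toFinset, wt k R x = wt k R q + (m.map (wt k R)).sum := by
      rw [Finset.sum_insert hq', List.sum_toFinset _ hm]
    rw [← hw] at h1 h2 ⊢
    refine ih (m.length + 1) hlen _ ?_ ?_ q (Finset.mem_insert_self _ _) hex h1 h2
    · rw [Finset.card_insert_of_notMem hq', List.toFinset_card_of_nodup hm]
    · intro x hx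
      simp only [Finset.mem_insert, List.mem_toFinset] at hx
      rcases hx with rfl | hx
      · exact hS _ hqS
      · exact hS x (hmS x hx)
  have HP : ∀ l1 q l2, l = l1 ++ q :: l2 → (l2.map (wt k R)).sum ≠ 0 →
      -(k : ℤ) ≤ wt k R p + ((l1.map (wt k R)).sum + wt k R q) →
      wt k R p + ((l1.map (wt k R)).sum + wt k R q) ≤ 1 →
      -(k : ℤ) ≤ wt k R p + (l2.map (wt k R)).sum →
      wt k R p + (l2.map (wt k R)).sum ≤ 1 → ∀ d,
      bd k R p (wt k R p + ((l1.map (wt k R)).sum + wt k R q)) +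
        bd k R p (wt k R p + (l2.map (wt k R)).sum) ≤ d → d ≤ k + 2 → Good k R S p d := by
    intro l1 q l2 hdec hne h1 h2 h3 h4 d hd hd'
    have hl2 : 0 < l2.length := by
      rcases l2 with _ | ⟨x, l2⟩
      · simp at hne
      · simp
    have hle : l.length = l1.length + (l2.length + 1) := by rw [hdec]; simp
    have hsum : ((l1 ++ [q]).map (wt k R)).sum = (l1.map (wt k R)).sum + wt k R q := by simp
    have sub1 : ∀ x ∈ l1 ++ [q], x ∈ l := by
      intro x hx; rw [hdec]; simp at hx ⊢; tauto
    have sub2 : ∀ x ∈ l2, x ∈ l := by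
      intro x hx; rw [hdec]; simp [hx]
    have hexp : ∀ m : List Pt, (∀ x ∈ m, x ∈ l) → Extr (insert p m.toFinset) p := by
      intro m hm
      obtain ⟨a, b, hab⟩ := he
      refine ⟨a, b, fun x hx hxp => hab x ?_ hxp⟩
      simp only [Finset.mem_insert, List.mem_toFinset] at hx
      rcases hx with rfl | hx
      · exact hp
      · exact (hmemS x (hm x hx)).1
    have nd' : (l1 ++ [q]).Nodup ∧ l2.Nodup := by
      have h' : ((l1 ++ [q]) ++ l2).Nodup := by rw [hdec] at hnd; simpa using hnd
      exact ⟨(List.nodup_append.1 h').1, (List.nodup_append.1 h').2.1⟩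
    have g1 := rec' (l1 ++ [q]) p nd'.1 (fun h => (hmemS p (sub1 p h)).2 rfl)
      (fun x hx => (hmemS x (sub1 x hx)).1) hp (by simp; omega) (hexp _ sub1)
      (by rw [hsum]; exact h1) (by rw [hsum]; exact h2)
    have g2 := rec' l2 p nd'.2 (fun h => (hmemS p (sub2 p h)).2 rfl)
      (fun x hx => (hmemS x (sub2 x hx)).1) hp (by omega) (hexp _ sub2) h3 h4
    rw [hsum] at g1
    rw [hdec] at hl hpw
    exact splitP hP hS hp hl hpw g1 g2 hd hd'
  have HQ : ∀ l1 q l2, l = l1 ++ q :: l2 → (p ∈ R ↔ q ∉ R) →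
      -(k : ℤ) ≤ wt k R q + (l1.map (wt k R)).sum →
      wt k R q + (l1.map (wt k R)).sum ≤ 1 →
      -(k : ℤ) ≤ wt k R q + (l2.map (wt k R)).sum →
      wt k R q + (l2.map (wt k R)).sum ≤ 1 →
      bd k R q (wt k R q + (l1.map (wt k R)).sum) +
        bd k R q (wt k R q + (l2.map (wt k R)).sum) + 1 ≤ k + 2 → Good k R S p 1 := by
    intro l1 q l2 hdec hc h1 h2 h3 h4 hd
    have hle : l.length = l1.length + (l2.length + 1) := by rw [hdec]; simp
    have sub1 : ∀ x ∈ l1, x ∈ l := by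
      intro x hx; rw [hdec]; simp [hx]
    have sub2 : ∀ x ∈ l2, x ∈ l := by
      intro x hx; rw [hdec]; simp [hx]
    have hql : q ∈ l := by rw [hdec]; simp
    rw [hdec] at hl hpw hnd
    have nd := List.nodup_append.1 hnd
    have nd2 := List.nodup_cons.1 nd.2.1
    have hq1 : q ∉ l1 := fun h => nd.2.2 q h q (by simp) rfl
    have hpw' := hpw
    rw [List.pairwise_append, List.pairwise_cons] at hpw'
    obtain ⟨-, ⟨hq2, -⟩, h12⟩ := hpw'
    have ex1 : Extr (insert q l1.toFinset) q := by
      refine ⟨-(-(q.2 - p.2)), -(q.1 - p.1), fun x hx hxq => ?_⟩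
      rw [neg_lf, dt_lf_q, ← dt_swap]
      simp only [Finset.mem_insert, List.mem_toFinset] at hx
      exact h12 x (hx.resolve_left hxq) q (by simp)
    have ex2 : Extr (insert q l2.toFinset) q := by
      refine ⟨-(q.2 - p.2), q.1 - p.1, fun x hx hxq => ?_⟩
      rw [dt_lf_q]
      simp only [Finset.mem_insert, List.mem_toFinset] at hx
      exact hq2 x (hx.resolve_left hxq)
    have g1 := rec' l1 q nd.1 hq1 (fun x hx => (hmemS x (sub1 x hx)).1) (hmemS q hql).1
      (by omega) ex1 h1 h2
    have g2 := rec' l2 q nd2.2 nd2.1 (fun x hx => (hmemS x (sub2 x hx)).1) (hmemS q hql).1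
      (by omega) ex2 h3 h4
    exact splitQ hP hS hp hl hpw hc g1 g2 hd
  have Hmono : ∀ d, Good k R S p 1 → 1 ≤ d → Good k R S p d := by
    rintro d ⟨G, h1, h2, h3⟩ hd
    exact ⟨G, h1, h2, h3.trans hd⟩
  have Hbase : l = [] → ∀ d, Good k R S p d := by
    intro h d
    have hSp : S = {p} := by
      rw [← Finset.insert_erase hp, ← hl, h]; simp
    rw [hSp]
    exact ⟨⊥, tr_single R p, by simp [deg_bot], by simp [deg_bot]⟩
  have hwR : ∀ x, x ∈ R → wt k R x = 1 := fun x hx => by simp [wt, hx]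
  have hwB : ∀ x, x ∉ R → wt k R x = -(k : ℤ) := fun x hx => by simp [wt, hx]
  have hbR : ∀ x W, x ∈ R → bd k R x W = max 1 (1 - W).toNat := fun x W hx => by simp [bd, hx]
  have hbB : ∀ x W, x ∉ R → bd k R x W = max 1 (W + k).toNat := fun x W hx => by simp [bd, hx]
  have hsplit : ∀ l1 q l2, l = l1 ++ q :: l2 → (l.map (wt k R)).sum =
      (l1.map (wt k R)).sum + wt k R q + (l2.map (wt k R)).sum := by
    intro l1 q l2 h; rw [h]; simp [add_assoc]
  clear hW ih rec' hpw hnd hl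
  generalize hT : (l.map (wt k R)).sum = T at *
  by_cases hpR : p ∈ R
  · -- red root
    have hwp := hwR p hpR
    rw [hwp] at hlo hhi ⊢
    rw [hbR p _ hpR]
    -- using a blue `q`
    have useQ : ∀ l1 q l2, l = l1 ++ q :: l2 → q ∉ R → 0 ≤ (l1.map (wt k R)).sum →
        (l1.map (wt k R)).sum - k ≤ T → Good k R S p (max 1 (1 - (1 + T)).toNat) := by
      intro l1 q l2 hdec hq h1 h2
      have hs := hsplit l1 q l2 hdec
      refine Hmono _ (HQ l1 q l2 hdec (by tauto) ?_ ?_ ?_ ?_ ?_) (by omega)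
      all_goals
        try rw [hbB q _ hq, hbB q _ hq]
        rw [hwB q hq] at *
        omega
    by_cases hneg : T < 0
    · obtain ⟨l1, q, l2, hdec, h1, h2⟩ := ivt (wt k R) (fun x => 0 ≤ x) l 0 le_rfl
        (by rw [hT]; omega)
      simp only [zero_add] at h1 h2
      have hq : q ∉ R := by
        intro hq
        rw [hwR q hq] at h2
        omega
      have hs := hsplit l1 q l2 hdec
      rw [hwB q hq] at h2 hs
      by_cases hc : (l1.map (wt k R)).sum - k ≤ T
      · exact useQ l1 q l2 hdec hq h1 hc
      · refine HP l1 q l2 hdec ?_ ?_ ?_ ?_ ?_ _ ?_ ?_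
        all_goals
          try rw [hbR p _ hpR, hbR p _ hpR]
          try rw [hwB q hq]
          try rw [hwp]
          omega
    · have hT0 : T = 0 := by omega
      rcases l with _ | ⟨v, l'⟩
      · exact Hbase rfl _
      · by_cases hv : v ∈ R
        · have hT' := hT
          rw [List.map_cons, List.sum_cons, hwR v hv] at hT'
          obtain ⟨l1, q, l2, hdec, h1, h2⟩ := ivt (wt k R) (fun x => 1 ≤ x) l' 1 le_rfl
            (by omega)
          have hq : q ∉ R := by
            intro hq
            rw [hwR q hq] at h2
            omega
          rw [hwB q hq] at h2
          refine useQ (v :: l1) q l2 (by simp [hdec]) hq ?_ ?_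
          all_goals
            rw [List.map_cons, List.sum_cons, hwR v hv]
            omega
        · exact useQ [] v l' rfl hv (by simp) (by simp; omega)
  · -- blue root
    have hwp := hwB p hpR
    rw [hwp] at hlo hhi ⊢
    rw [hbB p _ hpR]
    have useQ : ∀ l1 q l2, l = l1 ++ q :: l2 → q ∈ R → -1 ≤ (l1.map (wt k R)).sum →
        (l1.map (wt k R)).sum ≤ 0 → T ≤ 1 + (l1.map (wt k R)).sum →
        Good k R S p (max 1 (-(k : ℤ) + T + k).toNat) := by
      intro l1 q l2 hdec hq h1 h2 h3
      have hs := hsplit l1 q l2 hdec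
      refine Hmono _ (HQ l1 q l2 hdec (by tauto) ?_ ?_ ?_ ?_ ?_) (by omega)
      all_goals
        try rw [hbR q _ hq, hbR q _ hq]
        rw [hwR q hq] at *
        omega
    by_cases h0 : T = 0
    · rcases l with _ | ⟨v, l'⟩
      · exact Hbase rfl _
      · by_cases hv : v ∈ R
        · exact useQ [] v l' rfl hv (by simp) (by simp) (by simp; omega)
        · have hT' := hT
          rw [List.map_cons, List.sum_cons, hwB v hv] at hT'
          obtain ⟨l1, q, l2, hdec, h1, h2⟩ := ivt (wt k R) (fun x => x ≤ -1) l' (-(k : ℤ))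
            (by omega) (by omega)
          have hq : q ∈ R := by
            by_contra hq
            rw [hwB q hq] at h2
            omega
          rw [hwR q hq] at h2
          refine useQ (v :: l1) q l2 (by simp [hdec]) hq ?_ ?_ ?_
          all_goals
            rw [List.map_cons, List.sum_cons, hwB v hv]
            omega
    · obtain ⟨l1, q, l2, hdec, h1, h2⟩ := ivt (wt k R) (fun x => x ≤ 0) l 0 le_rfl
        (by rw [hT]; omega)
      simp only [zero_add] at h1 h2
      have hq : q ∈ R := by
        by_contra hq
        rw [hwB q hq] at h2
        omega
      have hs := hsplit l1 q l2 hdec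
      rw [hwR q hq] at h2 hs
      by_cases h1' : T = 1
      · exact useQ l1 q l2 hdec hq (by omega) h1 (by omega)
      · refine HP l1 q l2 hdec ?_ ?_ ?_ ?_ ?_ _ ?_ ?_
        all_goals
          try rw [hbB p _ hpR, hbB p _ hpR]
          try rw [hwR q hq]
          try rw [hwp]
          omega

theorem exists_extr {S : Finset Pt} (h : S.Nonempty) : ∃ p ∈ S, Extr S p := by
  obtain ⟨p, hp, hmax⟩ := S.exists_max_image (fun x => x.1 ^ 2 + x.2 ^ 2) h
  refine ⟨p, hp, -p.1, -p.2, fun x hx hxp => ?_⟩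
  have h1 := hmax x hx
  have h2 : 0 < (x.1 - p.1) ^ 2 + (x.2 - p.2) ^ 2 := by
    by_contra hn
    apply hxp
    have e1 : x.1 - p.1 = 0 := by nlinarith [sq_nonneg (x.1 - p.1), sq_nonneg (x.2 - p.2)]
    have e2 : x.2 - p.2 = 0 := by nlinarith [sq_nonneg (x.1 - p.1), sq_nonneg (x.2 - p.2)]
    ext <;> linarith
  simp only [lf]
  nlinarith

/-- If `|R| = k|B|` with `k ≥ 1`, `B` nonempty and `R ∪ B` in general
position, then there is a plane bichromatic tree on `R ∪ B` of maximum degree ≤ `k + 2`. -/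
theorem statement_3 (R B : Finset Pt) (hdisj : Disjoint R B) (hB : B.Nonempty)
    (k : ℕ) (hk : 1 ≤ k) (hcard : R.card = k * B.card)
    (hgp : GenPos (↑(R ∪ B) : Set Pt)) :
    ∃ G : SimpleGraph {x : Pt // x ∈ R ∪ B},
      PlaneBichromTree R B G ∧ ∀ v, deg G v ≤ k + 2 := by
  have hne : (R ∪ B).Nonempty := hB.mono Finset.subset_union_right
  obtain ⟨p, hp, hex⟩ := exists_extr hne
  have hsum : ∑ x ∈ R ∪ B, wt k R x = 0 := by
    rw [Finset.sum_union hdisj]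
    have h1 : ∑ x ∈ R, wt k R x = R.card := by
      rw [Finset.sum_congr rfl (fun x hx => show wt k R x = 1 by simp [wt, hx])]
      simp
    have h2 : ∑ x ∈ B, wt k R x = -(k * B.card : ℤ) := by
      rw [Finset.sum_congr rfl (fun x hx => show wt k R x = -(k : ℤ) by
        simp [wt, Finset.disjoint_right.1 hdisj hx])]
      simp [mul_comm]
    rw [h1, h2, hcard]
    push_cast
    ring
  obtain ⟨G, hT, hdeg, -⟩ := main_tree hk (R := R) hgp _ (R ∪ B) rfl (fun x hx => by simpa using hx)
    p hp hex (by rw [hsum]; omega) (by rw [hsum]; omega)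
  have hinj : Function.Injective (Subtype.val : {x : Pt // x ∈ R ∪ B} → Pt) :=
    Subtype.val_injective
  refine ⟨G.comap Subtype.val, ⟨?_, ?_, ?_⟩, ?_⟩
  · have hreach : ∀ u v : Pt, G.Walk u v → ∀ (hu : u ∈ R ∪ B) (hv : v ∈ R ∪ B),
        (G.comap (Subtype.val : {x : Pt // x ∈ R ∪ B} → Pt)).Reachable ⟨u, hu⟩ ⟨v, hv⟩ := by
      intro u v w
      induction w with
      | nil => intro hu hv; rfl
      | cons h w ih =>
        intro hu hv
        have hm := hT.supp _ _ h.symm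
        refine SimpleGraph.Reachable.trans (SimpleGraph.Adj.reachable ?_) (ih hm hv)
        simpa using h
    have hconn : (G.comap (Subtype.val : {x : Pt // x ∈ R ∪ B} → Pt)).Connected := by
      rw [SimpleGraph.connected_iff]
      refine ⟨?_, ⟨⟨p, hp⟩⟩⟩
      rintro ⟨u, hu⟩ ⟨v, hv⟩
      obtain ⟨w⟩ := hT.conn u hu v hv
      exact hreach u v w hu hv
    rw [SimpleGraph.isTree_iff_connected_and_card]
    refine ⟨hconn, le_antisymm ?_ hconn.card_vert_le_card_edgeSet_add_one⟩
    have h1 : (G.comap (Subtype.val : {x : Pt // x ∈ R ∪ B} → Pt)).edgeSet.ncard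
        ≤ G.edgeSet.ncard := by
      refine Set.ncard_le_ncard_of_injOn (Sym2.map Subtype.val) ?_
        (Sym2.map.injective hinj).injOn hT.fin
      intro e he
      induction e with
      | _ x y => simpa using he
    have h2 := hT.cnt
    have h3 : Nat.card {x : Pt // x ∈ R ∪ B} = (R ∪ B).card := by
      rw [Nat.card_eq_fintype_card, Fintype.card_coe]
    rw [h3, Nat.card_coe_set_eq]
    omega
  · rintro ⟨u, hu⟩ ⟨v, hv⟩ h
    have hb := hT.bic u v h
    simp only [Finset.mem_union] at hu hv
    by_cases huR : u ∈ R
    · left; exact ⟨huR, hv.resolve_left (hb.1 huR)⟩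
    · right; exact ⟨hu.resolve_left huR, by tauto⟩
  · intro u v x y h1 h2 hne' z hz1 hz2
    refine hT.pln u.1 v.1 x.1 y.1 h1 h2 ?_ z hz1 hz2
    intro h
    apply hne'
    apply Sym2.map.injective hinj
    simpa using h
  · intro v
    refine le_trans ?_ (hdeg v.1)
    refine Set.ncard_le_ncard_of_injOn Subtype.val ?_ hinj.injOn ?_
    · intro x hx
      simpa using hx
    · refine (Finset.finite_toSet (R ∪ B)).subset ?_
      intro x hx
      exact hT.supp _ _ (SimpleGraph.Adj.symm hx)
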